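/- Let f: 𝒞 → B be a smoothing of an irreducible plane cubic C over ℂ having a node (respectively a cusp), and set k = 3 (respectively k = 1). Then exactly k lines cutting C at a smooth point with intersection multiplicity 3 arise as degenerations of inflection lines of the general fiber of f; equivalently, an irreducible plane cubic with a node has exactly 3 lines meeting it at a smooth point with multiplicity 3, and an irreducible plane cubic with a cusp has exactly 1 such line. -/

import Mathlib

/-!
STATEMENT 13 (Pacini–Testa, Lemma `dual-cubic`): let `C` be an irreducible plane cubic
over ℂ with a node (resp. a cusp) and set `k = 3` (resp. `k = 1`).  Then exactly `k`
lines cut `C` at a smooth point with intersection multiplicity `3`; these are exactly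
the lines arising as degenerations of inflection lines of the general fiber of a
smoothing of `C` (the equivalent counting form licensed by the statement).

Lines are counted as points of the dual projective plane
`Projectivization ℂ (Fin 3 → ℂ)`.
-/

open MvPolynomial Polynomial

noncomputable section

namespace Infl

def dotv (w p : Fin 3 → ℂ) : ℂ := ∑ i, w i * p i

def lineRestrict (F : MvPolynomial (Fin 3) ℂ) (a b : Fin 3 → ℂ) : Polynomial ℂ :=
  MvPolynomial.aeval (fun i => Polynomial.C (a i) + Polynomial.C (b i) * Polynomial.X) F

def contactAt (F : MvPolynomial (Fin 3) ℂ) (a b : Fin 3 → ℂ) : ℕ :=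
  (lineRestrict F a b).rootMultiplicity 0

def SmoothAt (F : MvPolynomial (Fin 3) ℂ) (p : Fin 3 → ℂ) : Prop :=
  eval p F = 0 ∧ ∃ i, eval p (pderiv i F) ≠ 0

def SingAt (F : MvPolynomial (Fin 3) ℂ) (p : Fin 3 → ℂ) : Prop :=
  eval p F = 0 ∧ ∀ i, eval p (pderiv i F) = 0

def hessMat (F : MvPolynomial (Fin 3) ℂ) (p : Fin 3 → ℂ) : Matrix (Fin 3) (Fin 3) ℂ :=
  Matrix.of fun i j => eval p (pderiv i (pderiv j F))

def cubicForm (F : MvPolynomial (Fin 3) ℂ) (p v : Fin 3 → ℂ) : ℂ :=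
  ∑ i, ∑ j, ∑ l, eval p (pderiv i (pderiv j (pderiv l F))) * v i * v j * v l

def IsNodeAt (F : MvPolynomial (Fin 3) ℂ) (p : Fin 3 → ℂ) : Prop :=
  SingAt F p ∧ (hessMat F p).rank = 2

def IsCuspAt (F : MvPolynomial (Fin 3) ℂ) (p : Fin 3 → ℂ) : Prop :=
  SingAt F p ∧ (hessMat F p).rank = 1 ∧
    ∀ v, (hessMat F p).mulVec v = 0 → LinearIndependent ℂ ![p, v] → cubicForm F p v ≠ 0

/-- The line with dual vector `w` cuts `{F = 0}` at a smooth point with intersection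
multiplicity exactly `3`. -/
def IsSmoothFlexLine (F : MvPolynomial (Fin 3) ℂ) (w : Fin 3 → ℂ) : Prop :=
  ∃ a b : Fin 3 → ℂ, dotv w a = 0 ∧ dotv w b = 0 ∧ LinearIndependent ℂ ![a, b] ∧
    SmoothAt F a ∧ contactAt F a b = 3


/-! ### Function-level description of cubics -/

/-- Ten coefficient cubic form, as a function. -/
def IsCubic (f : (Fin 3 → ℂ) → ℂ) : Prop :=
  ∃ c0 c1 c2 c3 c4 c5 c6 c7 c8 c9 : ℂ, ∀ x, f x =
    c0 * x 0 ^ 3 + c1 * x 1 ^ 3 + c2 * x 2 ^ 3 + c3 * (x 0 ^ 2 * x 1) + c4 * (x 0 ^ 2 * x 2)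
    + c5 * (x 1 ^ 2 * x 0) + c6 * (x 1 ^ 2 * x 2) + c7 * (x 2 ^ 2 * x 0) + c8 * (x 2 ^ 2 * x 1)
    + c9 * (x 0 * x 1 * x 2)

/-- Directional derivative of a cubic form at `a` along `c`. -/
def Dd (f : (Fin 3 → ℂ) → ℂ) (a c : Fin 3 → ℂ) : ℂ := (f (a + c) - f (a - c)) / 2 - f c

/-- Full polarization. -/
def Tt (f : (Fin 3 → ℂ) → ℂ) (p v w : Fin 3 → ℂ) : ℂ :=
  f (p + v + w) - f (p + v) - f (p + w) - f (v + w) + f p + f v + f w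

def FlexF (f : (Fin 3 → ℂ) → ℂ) (w : Fin 3 → ℂ) : Prop :=
  ∃ a b : Fin 3 → ℂ, dotv w a = 0 ∧ dotv w b = 0 ∧ LinearIndependent ℂ ![a, b] ∧
    (f a = 0 ∧ ∃ c, Dd f a c ≠ 0) ∧ Dd f a b = 0 ∧ Dd f b a = 0 ∧ f b ≠ 0

def Cub10 (F : MvPolynomial (Fin 3) ℂ) : Prop :=
  ∃ c0 c1 c2 c3 c4 c5 c6 c7 c8 c9 : ℂ, F =
    MvPolynomial.C c0 * MvPolynomial.X 0 ^ 3 + MvPolynomial.C c1 * MvPolynomial.X 1 ^ 3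
    + MvPolynomial.C c2 * MvPolynomial.X 2 ^ 3
    + MvPolynomial.C c3 * (MvPolynomial.X 0 ^ 2 * MvPolynomial.X 1)
    + MvPolynomial.C c4 * (MvPolynomial.X 0 ^ 2 * MvPolynomial.X 2)
    + MvPolynomial.C c5 * (MvPolynomial.X 1 ^ 2 * MvPolynomial.X 0)
    + MvPolynomial.C c6 * (MvPolynomial.X 1 ^ 2 * MvPolynomial.X 2)
    + MvPolynomial.C c7 * (MvPolynomial.X 2 ^ 2 * MvPolynomial.X 0)
    + MvPolynomial.C c8 * (MvPolynomial.X 2 ^ 2 * MvPolynomial.X 1)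
    + MvPolynomial.C c9 * (MvPolynomial.X 0 * MvPolynomial.X 1 * MvPolynomial.X 2)

lemma cub10_add {F G : MvPolynomial (Fin 3) ℂ} (hF : Cub10 F) (hG : Cub10 G) :
    Cub10 (F + G) := by
  obtain ⟨c0, c1, c2, c3, c4, c5, c6, c7, c8, c9, rfl⟩ := hF
  obtain ⟨d0, d1, d2, d3, d4, d5, d6, d7, d8, d9, rfl⟩ := hG
  refine ⟨c0 + d0, c1 + d1, c2 + d2, c3 + d3, c4 + d4, c5 + d5, c6 + d6, c7 + d7, c8 + d8,
    c9 + d9, ?_⟩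
  simp only [map_add]
  ring

lemma cub10_zero : Cub10 0 :=
  ⟨0, 0, 0, 0, 0, 0, 0, 0, 0, 0, by simp⟩

lemma cub10_monomial (d : Fin 3 →₀ ℕ) (c : ℂ) (h : d 0 + d 1 + d 2 = 3) :
    Cub10 (MvPolynomial.monomial d c) := by
  rw [MvPolynomial.monomial_eq, Finsupp.prod_fintype _ _ (by simp), Fin.prod_univ_three]
  generalize d 0 = i at *
  generalize d 1 = j at *
  generalize d 2 = k at *
  have hi : i ≤ 3 := by omega
  have hj : j ≤ 3 := by omega
  obtain rfl : k = 3 - i - j := by omega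
  interval_cases i <;> interval_cases j <;> first | omega | skip
  · exact ⟨0, 0, c, 0, 0, 0, 0, 0, 0, 0, by simp⟩
  · exact ⟨0, 0, 0, 0, 0, 0, 0, 0, c, 0, by simp; left; ring⟩
  · exact ⟨0, 0, 0, 0, 0, 0, c, 0, 0, 0, by simp⟩
  · exact ⟨0, c, 0, 0, 0, 0, 0, 0, 0, 0, by simp⟩
  · exact ⟨0, 0, 0, 0, 0, 0, 0, c, 0, 0, by simp; left; ring⟩
  · exact ⟨0, 0, 0, 0, 0, 0, 0, 0, 0, c, by simp⟩
  · exact ⟨0, 0, 0, 0, 0, c, 0, 0, 0, 0, by simp; left; ring⟩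
  · exact ⟨0, 0, 0, 0, c, 0, 0, 0, 0, 0, by simp⟩
  · exact ⟨0, 0, 0, c, 0, 0, 0, 0, 0, 0, by simp⟩
  · exact ⟨c, 0, 0, 0, 0, 0, 0, 0, 0, 0, by simp⟩

lemma cub10_of_homog {F : MvPolynomial (Fin 3) ℂ} (hF : F.IsHomogeneous 3) : Cub10 F := by
  rw [F.as_sum]
  refine Finset.sum_induction _ Cub10 (fun _ _ => cub10_add) cub10_zero ?_
  intro d hd
  apply cub10_monomial
  have h := hF (MvPolynomial.mem_support_iff.1 hd)
  rw [Finsupp.weight_apply, Finsupp.sum_fintype _ _ (by simp), Fin.sum_univ_three] at h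
  simpa using h

lemma isCubic_of_cub10 {F : MvPolynomial (Fin 3) ℂ} (hF : Cub10 F) :
    IsCubic (fun x => eval x F) := by
  obtain ⟨c0, c1, c2, c3, c4, c5, c6, c7, c8, c9, rfl⟩ := hF
  exact ⟨c0, c1, c2, c3, c4, c5, c6, c7, c8, c9, fun x => by simp⟩

lemma pderiv_two (i : Fin 3) : pderiv i (2 : MvPolynomial (Fin 3) ℂ) = 0 := by
  have : (2 : MvPolynomial (Fin 3) ℂ) = MvPolynomial.C 2 := (map_ofNat MvPolynomial.C 2).symm
  rw [this, pderiv_C]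

lemma pderiv_three (i : Fin 3) : pderiv i (3 : MvPolynomial (Fin 3) ℂ) = 0 := by
  have : (3 : MvPolynomial (Fin 3) ℂ) = MvPolynomial.C 3 := (map_ofNat MvPolynomial.C 3).symm
  rw [this, pderiv_C]

lemma Dd_eq {F : MvPolynomial (Fin 3) ℂ} (hF : Cub10 F) (a c : Fin 3 → ℂ) :
    Dd (fun x => eval x F) a c = ∑ i, c i * eval a (pderiv i F) := by
  obtain ⟨c0, c1, c2, c3, c4, c5, c6, c7, c8, c9, rfl⟩ := hF
  simp [Dd, Fin.sum_univ_three, pderiv_X, Pi.single_apply, pderiv_two, pderiv_three]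
  ring

lemma Tt_eq {F : MvPolynomial (Fin 3) ℂ} (hF : Cub10 F) (p v w : Fin 3 → ℂ) :
    Tt (fun x => eval x F) p v w = v ⬝ᵥ (hessMat F p).mulVec w := by
  obtain ⟨c0, c1, c2, c3, c4, c5, c6, c7, c8, c9, rfl⟩ := hF
  simp [Tt, Matrix.mulVec, dotProduct, hessMat, Fin.sum_univ_three, pderiv_X, Pi.single_apply, pderiv_two, pderiv_three]
  ring

lemma cubicForm_eq {F : MvPolynomial (Fin 3) ℂ} (hF : Cub10 F) (p v : Fin 3 → ℂ) :
    cubicForm F p v = 6 * eval v F := by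
  obtain ⟨c0, c1, c2, c3, c4, c5, c6, c7, c8, c9, rfl⟩ := hF
  simp [cubicForm, Fin.sum_univ_three, pderiv_X, Pi.single_apply, pderiv_two, pderiv_three]
  ring

lemma cubic_line {f : (Fin 3 → ℂ) → ℂ} (hf : IsCubic f) (a b : Fin 3 → ℂ) (x y : ℂ) :
    f (x • a + y • b) = x ^ 3 * f a + x ^ 2 * y * Dd f a b + x * y ^ 2 * Dd f b a
      + y ^ 3 * f b := by
  obtain ⟨c0, c1, c2, c3, c4, c5, c6, c7, c8, c9, h⟩ := hf
  simp only [Dd, h, Pi.add_apply, Pi.sub_apply, Pi.smul_apply, smul_eq_mul]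
  ring

lemma cubic_three {f : (Fin 3 → ℂ) → ℂ} (hf : IsCubic f) (a b c : Fin 3 → ℂ) (x y z : ℂ) :
    f (x • a + y • b + z • c) = x ^ 3 * f a + y ^ 3 * f b + z ^ 3 * f c
      + x ^ 2 * y * Dd f a b + x ^ 2 * z * Dd f a c + y ^ 2 * x * Dd f b a
      + y ^ 2 * z * Dd f b c + z ^ 2 * x * Dd f c a + z ^ 2 * y * Dd f c b
      + x * y * z * Tt f a b c := by
  obtain ⟨c0, c1, c2, c3, c4, c5, c6, c7, c8, c9, h⟩ := hf
  simp only [Dd, Tt, h, Pi.add_apply, Pi.sub_apply, Pi.smul_apply, smul_eq_mul]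
  ring

lemma lineRestrict_eq {F : MvPolynomial (Fin 3) ℂ} (hF : Cub10 F) (a b : Fin 3 → ℂ) :
    lineRestrict F a b = Polynomial.C (eval a F)
      + Polynomial.C (Dd (fun x => eval x F) a b) * Polynomial.X
      + Polynomial.C (Dd (fun x => eval x F) b a) * Polynomial.X ^ 2
      + Polynomial.C (eval b F) * Polynomial.X ^ 3 := by
  obtain ⟨c0, c1, c2, c3, c4, c5, c6, c7, c8, c9, rfl⟩ := hF
  apply Polynomial.funext
  intro t
  simp [lineRestrict, Dd]
  ring

lemma smoothAt_iff {F : MvPolynomial (Fin 3) ℂ} (hF : Cub10 F) (a : Fin 3 → ℂ) :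
    SmoothAt F a ↔ eval a F = 0 ∧ ∃ c, Dd (fun x => eval x F) a c ≠ 0 := by
  simp only [SmoothAt, Dd_eq hF]
  refine and_congr_right fun _ => ⟨?_, ?_⟩
  · rintro ⟨i, hi⟩
    exact ⟨Pi.single i 1, by simpa [Pi.single_apply] using hi⟩
  · rintro ⟨c, hc⟩
    by_contra! h
    exact hc (by simp [h])

lemma contactAt_iff {F : MvPolynomial (Fin 3) ℂ} (hF : Cub10 F) (a b : Fin 3 → ℂ) :
    contactAt F a b = 3 ↔ eval a F = 0 ∧ Dd (fun x => eval x F) a b = 0 ∧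
      Dd (fun x => eval x F) b a = 0 ∧ eval b F ≠ 0 := by
  unfold contactAt
  rw [lineRestrict_eq hF]
  generalize eval a F = c0
  generalize eval b F = c3
  generalize Dd (fun x => eval x F) a b = c1
  generalize Dd (fun x => eval x F) b a = c2
  constructor
  · intro h
    set P : Polynomial ℂ := Polynomial.C c0 + Polynomial.C c1 * Polynomial.X
      + Polynomial.C c2 * Polynomial.X ^ 2 + Polynomial.C c3 * Polynomial.X ^ 3 with hP
    have hP0 : P ≠ 0 := by
      intro h0
      rw [h0] at h
      simp at h
    have hd := (Polynomial.le_rootMultiplicity_iff hP0).1 h.ge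
    rw [map_zero, sub_zero, Polynomial.X_pow_dvd_iff] at hd
    have e0 := hd 0 (by norm_num)
    have e1 := hd 1 (by norm_num)
    have e2 := hd 2 (by norm_num)
    simp [hP, Polynomial.coeff_X, Polynomial.coeff_C, Polynomial.coeff_X_pow] at e0 e1 e2
    refine ⟨e0, e1, e2, ?_⟩
    rintro rfl
    apply hP0
    simp [hP, e0, e1, e2]
  · rintro ⟨rfl, rfl, rfl, h3⟩
    rw [Polynomial.rootMultiplicity_eq_natTrailingDegree']
    simp only [map_zero, zero_mul, zero_add]
    rw [Polynomial.C_mul_X_pow_eq_monomial, Polynomial.natTrailingDegree_monomial h3]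

lemma flex_iff {F : MvPolynomial (Fin 3) ℂ} (hF : Cub10 F) (w : Fin 3 → ℂ) :
    IsSmoothFlexLine F w ↔ FlexF (fun x => eval x F) w := by
  unfold IsSmoothFlexLine FlexF
  simp only [smoothAt_iff hF, contactAt_iff hF]
  refine exists_congr fun a => exists_congr fun b => ?_
  tauto

/-! ### Linear changes of coordinates -/

def LinEq (f g : (Fin 3 → ℂ) → ℂ) : Prop :=
  ∃ M N : Matrix (Fin 3) (Fin 3) ℂ, M * N = 1 ∧ N * M = 1 ∧ ∀ x, f (M.mulVec x) = g x

lemma LinEq.trans {f g h : (Fin 3 → ℂ) → ℂ} (h1 : LinEq f g) (h2 : LinEq g h) : LinEq f h := by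
  obtain ⟨M, N, hMN, hNM, e⟩ := h1
  obtain ⟨M₁, N₁, hMN', hNM', e₁⟩ := h2
  refine ⟨M * M₁, N₁ * N, ?_, ?_, fun x => ?_⟩
  · rw [Matrix.mul_assoc, ← Matrix.mul_assoc M₁, hMN', Matrix.one_mul, hMN]
  · rw [Matrix.mul_assoc, ← Matrix.mul_assoc N, hNM, Matrix.one_mul, hNM']
  · rw [← Matrix.mulVec_mulVec, e, e₁]

lemma linEq_of_left {f g : (Fin 3 → ℂ) → ℂ} (M N : Matrix (Fin 3) (Fin 3) ℂ) (h : M * N = 1)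
    (e : ∀ x, f (M.mulVec x) = g x) : LinEq f g :=
  ⟨M, N, h, mul_eq_one_comm.1 h, e⟩

lemma li_map {M N : Matrix (Fin 3) (Fin 3) ℂ} (hNM : N * M = 1) {a b : Fin 3 → ℂ}
    (h : LinearIndependent ℂ ![a, b]) : LinearIndependent ℂ ![M.mulVec a, M.mulVec b] := by
  rw [LinearIndependent.pair_iff] at h ⊢
  intro s t hst
  apply h s t
  have := congrArg N.mulVec hst
  simpa [Matrix.mulVec_add, Matrix.mulVec_smul, hNM] using this

lemma Dd_comp {f g : (Fin 3 → ℂ) → ℂ} {M : Matrix (Fin 3) (Fin 3) ℂ}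
    (e : ∀ x, f (M.mulVec x) = g x) (a c : Fin 3 → ℂ) :
    Dd f (M.mulVec a) (M.mulVec c) = Dd g a c := by
  simp only [Dd, ← Matrix.mulVec_add, ← Matrix.mulVec_sub, e]

lemma Tt_comp {f g : (Fin 3 → ℂ) → ℂ} {M : Matrix (Fin 3) (Fin 3) ℂ}
    (e : ∀ x, f (M.mulVec x) = g x) (a b c : Fin 3 → ℂ) :
    Tt f (M.mulVec a) (M.mulVec b) (M.mulVec c) = Tt g a b c := by
  simp only [Tt, ← Matrix.mulVec_add, e]

lemma dotv_comp (w x : Fin 3 → ℂ) (M : Matrix (Fin 3) (Fin 3) ℂ) :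
    dotv w (M.mulVec x) = dotv (Matrix.vecMul w M) x :=
  Matrix.dotProduct_mulVec w M x

lemma flexF_comp_aux {f g : (Fin 3 → ℂ) → ℂ} {M N : Matrix (Fin 3) (Fin 3) ℂ}
    (hNM : N * M = 1) (e : ∀ x, f (M.mulVec x) = g x) (w : Fin 3 → ℂ)
    (h : FlexF g (Matrix.vecMul w M)) : FlexF f w := by
  obtain ⟨a, b, ha, hb, hli, ⟨h0, c, hc⟩, h1, h2, h3⟩ := h
  refine ⟨M.mulVec a, M.mulVec b, ?_, ?_, li_map hNM hli, ⟨?_, M.mulVec c, ?_⟩, ?_, ?_, ?_⟩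
  · rwa [dotv_comp]
  · rwa [dotv_comp]
  · rwa [e]
  · rwa [Dd_comp e]
  · rwa [Dd_comp e]
  · rwa [Dd_comp e]
  · rwa [e]

lemma flexF_comp {f g : (Fin 3 → ℂ) → ℂ} {M N : Matrix (Fin 3) (Fin 3) ℂ}
    (hMN : M * N = 1) (hNM : N * M = 1) (e : ∀ x, f (M.mulVec x) = g x) (w : Fin 3 → ℂ) :
    FlexF f w ↔ FlexF g (Matrix.vecMul w M) := by
  refine ⟨fun h => ?_, flexF_comp_aux hNM e w⟩
  apply flexF_comp_aux (f := g) (g := f) hMN (M := N) (N := M)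
  · intro x
    rw [← e, Matrix.mulVec_mulVec, hMN, Matrix.one_mulVec]
  · rwa [Matrix.vecMul_vecMul, hMN, Matrix.vecMul_one]

lemma count {ι : Type} {f g : (Fin 3 → ℂ) → ℂ} (hfg : LinEq f g) (S : Set ι)
    (W : ι → Fin 3 → ℂ) (hW0 : ∀ i, W i 0 = 1)
    (hinj : ∀ i j, W i = W j → i = j)
    (hflex : ∀ w : Fin 3 → ℂ, w ≠ 0 → (FlexF g w ↔ ∃ i ∈ S, ∃ c : ℂ, c ≠ 0 ∧ w = c • W i)) :
    {l : Projectivization ℂ (Fin 3 → ℂ) | FlexF f l.rep}.ncard = S.ncard := by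
  obtain ⟨M, N, hMN, hNM, e⟩ := hfg
  have hWne : ∀ i, W i ≠ 0 := fun i h => by
    have := hW0 i
    rw [h] at this
    simp at this
  have hne : ∀ i, Matrix.vecMul (W i) N ≠ 0 := fun i h => by
    apply hWne i
    have := congrArg (fun v => Matrix.vecMul v M) h
    simpa [Matrix.vecMul_vecMul, hNM] using this
  have hset : {l : Projectivization ℂ (Fin 3 → ℂ) | FlexF f l.rep} =
      (fun i => Projectivization.mk ℂ (Matrix.vecMul (W i) N) (hne i)) '' S := by
    ext l
    simp only [Set.mem_ofPred_eq, Set.mem_image]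
    have hl : Matrix.vecMul l.rep M ≠ 0 := fun h => by
      apply l.rep_nonzero
      have := congrArg (fun v => Matrix.vecMul v N) h
      simpa [Matrix.vecMul_vecMul, hMN] using this
    rw [flexF_comp hMN hNM e, hflex _ hl]
    refine exists_congr fun i => and_congr_right fun _ => ?_
    constructor
    · rintro ⟨c, hc, h⟩
      rw [← l.mk_rep, Projectivization.mk_eq_mk_iff']
      refine ⟨c⁻¹, ?_⟩
      have := congrArg (fun v => Matrix.vecMul v N) h
      simp only [Matrix.vecMul_vecMul, hMN, Matrix.vecMul_one, Matrix.smul_vecMul] at this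
      rw [this, smul_smul, inv_mul_cancel₀ hc, one_smul]
    · intro h
      rw [← l.mk_rep, Projectivization.mk_eq_mk_iff'] at h
      obtain ⟨c, hc⟩ := h
      have hc0 : c ≠ 0 := by
        rintro rfl
        exact hne i (by rw [← hc, zero_smul])
      have := congrArg (fun v => Matrix.vecMul v M) hc
      simp only [Matrix.vecMul_vecMul, hNM, Matrix.vecMul_one, Matrix.smul_vecMul] at this
      refine ⟨c⁻¹, inv_ne_zero hc0, ?_⟩
      rw [← this, smul_smul, inv_mul_cancel₀ hc0, one_smul]
  rw [hset, Set.ncard_image_of_injective]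
  intro i j hij
  simp only [Projectivization.mk_eq_mk_iff'] at hij
  obtain ⟨c, hc⟩ := hij
  have := congrArg (fun v => Matrix.vecMul v M) hc
  simp only [Matrix.vecMul_vecMul, hNM, Matrix.vecMul_one, Matrix.smul_vecMul] at this
  have h0 := congrFun this 0
  simp only [Pi.smul_apply, smul_eq_mul, hW0, mul_one] at h0
  rw [h0, one_smul] at this
  exact (hinj _ _ this).symm

/-! ### Flexes of the normal forms -/

lemma flexF_through {f : (Fin 3 → ℂ) → ℂ} (hf : IsCubic f)
    (h0 : ∀ t, f ![t, 0, 0] = 0) (h1 : ∀ t c, Dd f ![t, 0, 0] c = 0) (w : Fin 3 → ℂ)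
    (hw : w ≠ 0) (hw0 : w 0 = 0) : ¬ FlexF f w := by
  rintro ⟨a, b, ha, hb, -, ⟨hfa, c, hc⟩, hab, hba, hfb⟩
  simp only [dotv, Fin.sum_univ_three, hw0, zero_mul, zero_add] at ha hb
  have key : ∀ x y : ℂ, x * a 1 + y * b 1 = 0 → x * a 2 + y * b 2 = 0 → y = 0 := by
    intro x y e1 e2
    have h := cubic_line hf a b x y
    have hv : x • a + y • b = ![x * a 0 + y * b 0, 0, 0] := by
      ext i; fin_cases i <;> simp [e1, e2]
    rw [hv, h0, hfa, hab, hba] at h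
    have : y ^ 3 * f b = 0 := by linear_combination -h
    simpa [hfb] using this
  have hdet : a 1 * b 2 - a 2 * b 1 = 0 := by
    by_cases h1 : w 1 = 0
    · have h2 : w 2 ≠ 0 := by
        intro h2
        apply hw
        ext i; fin_cases i <;> simp [hw0, h1, h2]
      apply mul_left_cancel₀ h2
      linear_combination a 1 * hb - b 1 * ha + (a 1 * b 1 - b 1 * a 1) * h1
    · apply mul_left_cancel₀ h1
      linear_combination b 2 * ha - a 2 * hb
  have k1 := key (b 1) (-a 1) (by ring) (by linear_combination -hdet)
  have k2 := key (b 2) (-a 2) (by linear_combination hdet) (by ring)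
  have ha' : a = ![a 0, 0, 0] := by
    ext i; fin_cases i
    · simp
    · simpa using k1
    · simpa using k2
  rw [ha'] at hc
  exact hc (h1 _ _)

lemma flexF_affine {f : (Fin 3 → ℂ) → ℂ} (hf : IsCubic f) (w : Fin 3 → ℂ) (hw0 : w 0 ≠ 0)
    (h : FlexF f w) : ∃ κ α β : ℂ, ∀ y z,
      f ![-(w 1 * y + w 2 * z) / w 0, y, z] = κ * (α * y + β * z) ^ 3 := by
  obtain ⟨a, b, ha, hb, hli, ⟨hfa, c, hc⟩, hab, hba, hfb⟩ := h
  simp only [dotv, Fin.sum_univ_three] at ha hb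
  have hdet : a 1 * b 2 - a 2 * b 1 ≠ 0 := by
    intro hdet
    rw [LinearIndependent.pair_iff] at hli
    have key : ∀ x y : ℂ, x * a 1 + y * b 1 = 0 → x * a 2 + y * b 2 = 0 → x = 0 ∧ y = 0 := by
      intro x y e1 e2
      apply hli
      ext i; fin_cases i
      · simp
        apply mul_left_cancel₀ hw0
        linear_combination x * ha + y * hb - w 1 * e1 - w 2 * e2
      · simpa using e1
      · simpa using e2
    have k1 := key (b 1) (-a 1) (by ring) (by linear_combination -hdet)
    have k2 := key (b 2) (-a 2) (by linear_combination hdet) (by ring)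
    have := key 1 0 (by simpa using k1.2) (by simpa using k2.2)
    simp at this
  obtain ⟨δ, hδ⟩ : ∃ δ : ℂ, δ * (a 1 * b 2 - a 2 * b 1) = 1 := ⟨_, inv_mul_cancel₀ hdet⟩
  refine ⟨f b * δ ^ 3, -a 2, a 1, fun y z => ?_⟩
  have h := cubic_line hf a b (δ * (y * b 2 - z * b 1)) (δ * (a 1 * z - a 2 * y))
  have hv : (δ * (y * b 2 - z * b 1)) • a + (δ * (a 1 * z - a 2 * y)) • b
      = ![-(w 1 * y + w 2 * z) / w 0, y, z] := by
    ext i; fin_cases i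
    · simp only [Fin.zero_eta, Pi.add_apply, Pi.smul_apply, smul_eq_mul, Matrix.cons_val_zero]
      rw [eq_div_iff hw0]
      linear_combination (δ * (y * b 2 - z * b 1)) * ha + (δ * (a 1 * z - a 2 * y)) * hb
        - (w 1 * y + w 2 * z) * hδ
    · simp
      linear_combination y * hδ
    · simp
      linear_combination z * hδ
  rw [hv, hfa, hab, hba] at h
  rw [h]
  ring

def nodeF (x : Fin 3 → ℂ) : ℂ := x 0 * x 1 * x 2 + x 1 ^ 3 + x 2 ^ 3

def cuspF (x : Fin 3 → ℂ) : ℂ := x 0 * x 1 ^ 2 + x 2 ^ 3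

lemma nodeF_cubic : IsCubic nodeF :=
  ⟨0, 1, 1, 0, 0, 0, 0, 0, 0, 1, fun x => by simp [nodeF]; ring⟩

lemma cuspF_cubic : IsCubic cuspF :=
  ⟨0, 0, 1, 0, 0, 1, 0, 0, 0, 0, fun x => by simp [cuspF]; ring⟩

lemma flex_node (w : Fin 3 → ℂ) (hw : w ≠ 0) : FlexF nodeF w ↔
    ∃ ω ∈ {ω : ℂ | ω ^ 3 = 1}, ∃ c : ℂ, c ≠ 0 ∧ w = c • ![1, -3 * ω, -3 * ω ^ 2] := by
  constructor
  · intro h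
    by_cases hw0 : w 0 = 0
    · exact absurd h (flexF_through nodeF_cubic (by simp [nodeF])
        (by intro t c; simp [Dd, nodeF]; ring) w hw hw0)
    obtain ⟨κ, α, β, H⟩ := flexF_affine nodeF_cubic w hw0 h
    simp only [nodeF, Matrix.cons_val_zero, Matrix.cons_val_one, Matrix.cons_val] at H
    obtain ⟨m, hm⟩ : ∃ m, w 1 = w 0 * m := ⟨w 1 / w 0, by field_simp⟩
    obtain ⟨n, hn⟩ : ∃ n, w 2 = w 0 * n := ⟨w 2 / w 0, by field_simp⟩
    have Hq : ∀ y z, -(m * y + n * z) * y * z + y ^ 3 + z ^ 3 = κ * (α * y + β * z) ^ 3 := by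
      intro y z
      rw [← H y z, hm, hn]
      field_simp
    have e1 := Hq 1 0
    have e2 := Hq 0 1
    have e3 := Hq 1 1
    have e4 := Hq 1 (-1)
    have hα : α ≠ 0 := by
      rintro rfl
      simp at e1
    have f1 : κ * α ^ 3 = 1 := by linear_combination -e1
    have f2 : κ * β ^ 3 = 1 := by linear_combination -e2
    have f3 : -m = 3 * κ * α ^ 2 * β := by
      linear_combination (e3 - e4) / 2 - e2
    have f4 : -n = 3 * κ * α * β ^ 2 := by
      linear_combination (e3 + e4) / 2 - e1
    have hκ : κ = 1 / α ^ 3 := by field_simp; exact f1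
    refine ⟨β / α, ?_, w 0, hw0, ?_⟩
    · simp only [Set.mem_ofPred_eq]
      rw [hκ] at f2
      field_simp at f2 ⊢
      exact f2
    · rw [hκ] at f3 f4
      ext i; fin_cases i
      · simp
      · simp [hm]
        field_simp at f3 ⊢
        linear_combination -f3
      · simp [hn]
        field_simp at f4 ⊢
        linear_combination -f4
  · rintro ⟨ω, hω, c, hc, rfl⟩
    simp only [Set.mem_ofPred_eq] at hω
    have hω0 : ω ≠ 0 := by rintro rfl; simp at hω
    refine ⟨![0, -ω, 1], ![3 * ω, 1, 0], ?_, ?_, ?_, ⟨?_, ![1, 0, 0], ?_⟩, ?_, ?_, ?_⟩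
    · simp [dotv, Fin.sum_univ_three]; try ring
    · simp [dotv, Fin.sum_univ_three]; try ring
    · rw [LinearIndependent.pair_iff]
      intro s t hst
      have h1 := congrFun hst 1
      have h2 := congrFun hst 2
      simp at h1 h2
      subst h2
      simpa using h1
    · simp [nodeF]; linear_combination -hω
    · simp [Dd, nodeF]; intro h; apply hω0; linear_combination -h / 2
    · simp [Dd, nodeF]; ring
    · simp [Dd, nodeF]; linear_combination 0 * hω
    · simp [nodeF]

lemma flex_cusp (w : Fin 3 → ℂ) (hw : w ≠ 0) : FlexF cuspF w ↔
    ∃ i ∈ (Set.univ : Set Unit), ∃ c : ℂ, c ≠ 0 ∧ w = c • (fun _ : Unit => ![1, 0, 0]) i := by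
  constructor
  · intro h
    by_cases hw0 : w 0 = 0
    · exact absurd h (flexF_through cuspF_cubic (by simp [cuspF])
        (by intro t c; simp [Dd, cuspF]; ring) w hw hw0)
    obtain ⟨κ, α, β, H⟩ := flexF_affine cuspF_cubic w hw0 h
    simp only [cuspF, Matrix.cons_val_zero, Matrix.cons_val_one, Matrix.cons_val] at H
    obtain ⟨m, hm⟩ : ∃ m, w 1 = w 0 * m := ⟨w 1 / w 0, by field_simp⟩
    obtain ⟨n, hn⟩ : ∃ n, w 2 = w 0 * n := ⟨w 2 / w 0, by field_simp⟩
    have Hq : ∀ y z, -(m * y + n * z) * y ^ 2 + z ^ 3 = κ * (α * y + β * z) ^ 3 := by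
      intro y z
      rw [← H y z, hm, hn]
      field_simp
    have e1 := Hq 1 0
    have e2 := Hq 0 1
    have e3 := Hq 1 1
    have e4 := Hq 1 (-1)
    have f2 : κ * β ^ 3 = 1 := by linear_combination -e2
    have f4 : 0 = 3 * κ * α * β ^ 2 := by
      linear_combination (e3 + e4) / 2 - e1
    have hκ : κ ≠ 0 := by rintro rfl; simp at f2
    have hβ : β ≠ 0 := by rintro rfl; simp at f2
    have hα : α = 0 := by
      have := f4.symm
      simpa [hκ, hβ] using this
    subst hα
    have f1 : m = 0 := by linear_combination -e1
    have f3 : n = 0 := by linear_combination -(e3 - e4) / 2 + e2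
    refine ⟨(), trivial, w 0, hw0, ?_⟩
    ext i; fin_cases i <;> simp [hm, hn, f1, f3]
  · rintro ⟨-, -, c, hc, rfl⟩
    refine ⟨![0, 1, 0], ![0, 0, 1], ?_, ?_, ?_, ⟨?_, ![1, 0, 0], ?_⟩, ?_, ?_, ?_⟩
    · simp [dotv, Fin.sum_univ_three]
    · simp [dotv, Fin.sum_univ_three]
    · rw [LinearIndependent.pair_iff]
      intro s t hst
      have h1 := congrFun hst 1
      have h2 := congrFun hst 2
      simp at h1 h2
      exact ⟨h1, h2⟩
    · simp [cuspF]
    · simp [Dd, cuspF] <;> norm_num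
    · simp [Dd, cuspF] <;> norm_num
    · simp [Dd, cuspF] <;> norm_num
    · simp [cuspF]

/-! ### Reduction to normal form -/

def gform (A B C a b c d : ℂ) (x : Fin 3 → ℂ) : ℂ :=
  x 0 * (A * x 1 ^ 2 + B * x 1 * x 2 + C * x 2 ^ 2)
    + (a * x 1 ^ 3 + b * x 1 ^ 2 * x 2 + c * x 1 * x 2 ^ 2 + d * x 2 ^ 3)

lemma gform_subst (A B C a b c d α β γ δ A₁ B₁ C₁ : ℂ) (hD : α * δ - β * γ ≠ 0)
    (hA : A * α ^ 2 + B * α * γ + C * γ ^ 2 = A₁)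
    (hB : 2 * A * α * β + B * (α * δ + β * γ) + 2 * C * γ * δ = B₁)
    (hC : A * β ^ 2 + B * β * δ + C * δ ^ 2 = C₁) :
    LinEq (gform A B C a b c d) (gform A₁ B₁ C₁
      (a * α ^ 3 + b * α ^ 2 * γ + c * α * γ ^ 2 + d * γ ^ 3)
      (3 * a * α ^ 2 * β + b * (α ^ 2 * δ + 2 * α * β * γ) + c * (β * γ ^ 2 + 2 * α * γ * δ)
        + 3 * d * γ ^ 2 * δ)
      (3 * a * α * β ^ 2 + b * (β ^ 2 * γ + 2 * α * β * δ) + c * (α * δ ^ 2 + 2 * β * γ * δ)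
        + 3 * d * γ * δ ^ 2)
      (a * β ^ 3 + b * β ^ 2 * δ + c * β * δ ^ 2 + d * δ ^ 3)) := by
  obtain ⟨e, he⟩ : ∃ e : ℂ, e * (α * δ - β * γ) = 1 := ⟨_, inv_mul_cancel₀ hD⟩
  refine linEq_of_left !![1, 0, 0; 0, α, β; 0, γ, δ]
    !![1, 0, 0; 0, e * δ, -(e * β); 0, -(e * γ), e * α] ?_ fun x => ?_
  · ext i j
    fin_cases i <;> fin_cases j <;> simp [Matrix.mul_apply, Fin.sum_univ_three] <;>
      first | ring1 | linear_combination he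
  · subst hA hB hC
    simp [gform, Matrix.mulVec, dotProduct, Fin.sum_univ_three]
    ring

lemma exists_cube_root (a : ℂ) : ∃ α : ℂ, α ^ 3 = a :=
  IsAlgClosed.exists_pow_nat_eq a (by norm_num)

lemma linEq_node (a b c d : ℂ) (ha : a ≠ 0) (hd : d ≠ 0) :
    LinEq (gform 0 1 0 a b c d) nodeF := by
  obtain ⟨α, rfl⟩ := exists_cube_root a
  obtain ⟨δ, rfl⟩ := exists_cube_root d
  have hα : α ≠ 0 := by rintro rfl; simp at ha
  have hδ : δ ≠ 0 := by rintro rfl; simp at hd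
  refine linEq_of_left !![α * δ, -(b / α), -(c / δ); 0, 1 / α, 0; 0, 0, 1 / δ]
    !![1 / (α * δ), b / (α * δ), c / (α * δ); 0, α, 0; 0, 0, δ] ?_ fun x => ?_
  · ext i j
    fin_cases i <;> fin_cases j <;> simp [Matrix.mul_apply, Fin.sum_univ_three] <;>
      field_simp <;> ring
  · simp [gform, nodeF, Matrix.mulVec, dotProduct, Fin.sum_univ_three]
    field_simp
    ring

lemma linEq_cusp (a b c d : ℂ) (hd : d ≠ 0) :
    LinEq (gform 1 0 0 a b c d) cuspF := by
  obtain ⟨δ, rfl⟩ := exists_cube_root d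
  have hδ : δ ≠ 0 := by rintro rfl; simp at hd
  obtain ⟨h, rfl⟩ : ∃ h, c = 3 * δ ^ 2 * h := ⟨c / (3 * δ ^ 2), by field_simp⟩
  obtain ⟨b, rfl⟩ : ∃ b₁, b = δ * b₁ := ⟨b / δ, by field_simp⟩
  refine linEq_of_left !![1, -(2 * h ^ 3 - b * h + a), -(-3 * h ^ 2 + b); 0, 1, 0;
      0, -(h / δ), 1 / δ]
    !![1, (2 * h ^ 3 - b * h + a) + (-3 * h ^ 2 + b) * h, (-3 * h ^ 2 + b) * δ; 0, 1, 0;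
      0, h, δ] ?_ fun x => ?_
  · ext i j
    fin_cases i <;> fin_cases j <;> simp [Matrix.mul_apply, Fin.sum_univ_three] <;>
      field_simp <;> ring
  · simp [gform, cuspF, Matrix.mulVec, dotProduct, Fin.sum_univ_three]
    field_simp
    ring

lemma quad_node (A B C : ℂ) (h : B ^ 2 - 4 * A * C ≠ 0) : ∃ α β γ δ : ℂ,
    α * δ - β * γ ≠ 0 ∧ A * α ^ 2 + B * α * γ + C * γ ^ 2 = 0 ∧
    2 * A * α * β + B * (α * δ + β * γ) + 2 * C * γ * δ = 1 ∧
    A * β ^ 2 + B * β * δ + C * δ ^ 2 = 0 := by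
  by_cases hA : A = 0
  · subst hA
    have hB : B ≠ 0 := by rintro rfl; simp at h
    refine ⟨1, -C / B ^ 2, 0, B / B ^ 2, ?_, ?_, ?_, ?_⟩
    · simp [hB]
    · ring
    · field_simp; ring
    · field_simp; ring
  · obtain ⟨s, hs⟩ : ∃ s : ℂ, s ^ 2 = B ^ 2 - 4 * A * C :=
      IsAlgClosed.exists_pow_nat_eq _ (by norm_num)
    have hs0 : s ≠ 0 := by rintro rfl; apply h; rw [← hs]; simp
    obtain ⟨t, ht⟩ : ∃ t : ℂ, t * (-4 * A * s ^ 2) = 1 :=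
      ⟨_, inv_mul_cancel₀ (by simp [hA, hs0])⟩
    have ht0 : t ≠ 0 := by rintro rfl; simp at ht
    refine ⟨t * (-B + s), -B - s, t * (2 * A), 2 * A, ?_, ?_, ?_, ?_⟩
    · have : t * (-B + s) * (2 * A) - (-B - s) * (t * (2 * A)) = 4 * (t * A * s) := by ring
      rw [this]
      simp [ht0, hA, hs0]
    · linear_combination t ^ 2 * A * hs
    · linear_combination ht + 2 * t * A * hs
    · linear_combination A * hs

lemma quad_cusp (A B C : ℂ) (h : B ^ 2 - 4 * A * C = 0) : ∃ r s : ℂ,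
    A = r ^ 2 ∧ B = 2 * r * s ∧ C = s ^ 2 := by
  obtain ⟨r, rfl⟩ : ∃ r : ℂ, r ^ 2 = A := IsAlgClosed.exists_pow_nat_eq _ (by norm_num)
  by_cases hr : r = 0
  · obtain ⟨s, rfl⟩ : ∃ s : ℂ, s ^ 2 = C := IsAlgClosed.exists_pow_nat_eq _ (by norm_num)
    subst hr
    exact ⟨0, s, by simp, by simpa using h, rfl⟩
  · refine ⟨r, B / (2 * r), rfl, by field_simp, ?_⟩
    field_simp
    linear_combination -h

lemma exists_basis (p : Fin 3 → ℂ) (hp : p ≠ 0) : ∃ M N : Matrix (Fin 3) (Fin 3) ℂ,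
    M * N = 1 ∧ M.mulVec ![1, 0, 0] = p := by
  have : p 0 ≠ 0 ∨ p 1 ≠ 0 ∨ p 2 ≠ 0 := by
    by_contra! h
    apply hp
    ext i; fin_cases i <;> simp [h]
  rcases this with h | h | h
  · refine ⟨!![p 0, 0, 0; p 1, 1, 0; p 2, 0, 1],
      !![1 / p 0, 0, 0; -(p 1 / p 0), 1, 0; -(p 2 / p 0), 0, 1], ?_, ?_⟩
    · ext i j
      fin_cases i <;> fin_cases j <;> simp [Matrix.mul_apply, Fin.sum_univ_three, h] <;>
        field_simp <;> ring
    · ext i; fin_cases i <;> simp [Matrix.mulVec, dotProduct, Fin.sum_univ_three]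
  · refine ⟨!![p 0, 1, 0; p 1, 0, 0; p 2, 0, 1],
      !![0, 1 / p 1, 0; 1, -(p 0 / p 1), 0; 0, -(p 2 / p 1), 1], ?_, ?_⟩
    · ext i j
      fin_cases i <;> fin_cases j <;> simp [Matrix.mul_apply, Fin.sum_univ_three, h] <;>
        field_simp <;> ring
    · ext i; fin_cases i <;> simp [Matrix.mulVec, dotProduct, Fin.sum_univ_three]
  · refine ⟨!![p 0, 1, 0; p 1, 0, 1; p 2, 0, 0],
      !![0, 0, 1 / p 2; 1, 0, -(p 0 / p 2); 0, 1, -(p 1 / p 2)], ?_, ?_⟩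
    · ext i j
      fin_cases i <;> fin_cases j <;> simp [Matrix.mul_apply, Fin.sum_univ_three, h] <;>
        field_simp <;> ring
    · ext i; fin_cases i <;> simp [Matrix.mulVec, dotProduct, Fin.sum_univ_three]

lemma sing_form {f : (Fin 3 → ℂ) → ℂ} (hf : IsCubic f) (p : Fin 3 → ℂ) (hp : p ≠ 0)
    (h0 : f p = 0) (h1 : ∀ c, Dd f p c = 0) : ∃ M N : Matrix (Fin 3) (Fin 3) ℂ,
    M * N = 1 ∧ N * M = 1 ∧ M.mulVec ![1, 0, 0] = p ∧ ∃ A B C a b c d : ℂ,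
      ∀ x, f (M.mulVec x) = gform A B C a b c d x := by
  obtain ⟨M, N, hMN, hMp⟩ := exists_basis p hp
  refine ⟨M, N, hMN, mul_eq_one_comm.1 hMN, hMp, ?_⟩
  set m1 := M.mulVec ![0, 1, 0] with hm1
  set m2 := M.mulVec ![0, 0, 1] with hm2
  refine ⟨Dd f m1 p, Tt f p m1 m2, Dd f m2 p, f m1, Dd f m1 m2, Dd f m2 m1, f m2, fun x => ?_⟩
  have hx : M.mulVec x = x 0 • p + x 1 • m1 + x 2 • m2 := by
    rw [← hMp, hm1, hm2, ← Matrix.mulVec_smul, ← Matrix.mulVec_smul, ← Matrix.mulVec_smul,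
      ← Matrix.mulVec_add, ← Matrix.mulVec_add]
    congr 1
    ext i; fin_cases i <;> simp
  rw [hx, cubic_three hf, h0, h1, h1]
  simp only [gform]
  ring

lemma singAt_imp {F : MvPolynomial (Fin 3) ℂ} (hF : Cub10 F) {p : Fin 3 → ℂ}
    (h : SingAt F p) : eval p F = 0 ∧ ∀ c, Dd (fun x => eval x F) p c = 0 :=
  ⟨h.1, fun c => by rw [Dd_eq hF]; simp [h.2]⟩

lemma Tt_gform (A B C a b c d : ℂ) (u v : Fin 3 → ℂ) :
    Tt (gform A B C a b c d) ![1, 0, 0] u v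
      = 2 * A * (u 1 * v 1) + B * (u 1 * v 2 + u 2 * v 1) + 2 * C * (u 2 * v 2) := by
  simp only [Tt, gform, Pi.add_apply, Matrix.cons_val_zero, Matrix.cons_val_one, Matrix.cons_val]
  ring

lemma hess_rank {F : MvPolynomial (Fin 3) ℂ} (hF : Cub10 F) {p : Fin 3 → ℂ}
    {M N : Matrix (Fin 3) (Fin 3) ℂ} (hMN : M * N = 1) (hMp : M.mulVec ![1, 0, 0] = p)
    {A B C a b c d : ℂ} (e : ∀ x, eval (M.mulVec x) F = gform A B C a b c d x) :
    (hessMat F p).rank = (!![0, 0, 0; 0, 2 * A, B; 0, B, 2 * C] : Matrix (Fin 3) (Fin 3) ℂ).rank := by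
  have hM : IsUnit M.det := by
    rw [← Matrix.isUnit_iff_isUnit_det]
    exact IsUnit.of_mul_eq_one N hMN
  have key : M.transpose * hessMat F p * M = !![0, 0, 0; 0, 2 * A, B; 0, B, 2 * C] := by
    have hij : ∀ i j, (M.transpose * hessMat F p * M) i j =
        Tt (gform A B C a b c d) ![1, 0, 0] (Pi.single i 1) (Pi.single j 1) := by
      intro i j
      rw [← Tt_comp (f := fun x => eval x F) e, Tt_eq hF, hMp, Matrix.mulVec_single_one,
        Matrix.mulVec_single_one, Matrix.mul_assoc]
      simp only [Matrix.mul_apply, dotProduct, Matrix.mulVec, Matrix.transpose_apply, Matrix.col_apply]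
    ext i j
    rw [hij, Tt_gform]
    fin_cases i <;> fin_cases j <;> simp
  rw [← key, Matrix.rank_mul_eq_left_of_isUnit_det _ _ hM,
    Matrix.rank_mul_eq_right_of_isUnit_det _ _ (by rwa [Matrix.det_transpose])]

lemma rank_node (A B C : ℂ) (h : B ^ 2 - 4 * A * C = 0) :
    (!![0, 0, 0; 0, 2 * A, B; 0, B, 2 * C] : Matrix (Fin 3) (Fin 3) ℂ).rank ≤ 1 := by
  obtain ⟨r, s, rfl, rfl, rfl⟩ := quad_cusp A B C h
  have : (!![0, 0, 0; 0, 2 * r ^ 2, 2 * r * s; 0, 2 * r * s, 2 * s ^ 2] :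
      Matrix (Fin 3) (Fin 3) ℂ) = Matrix.vecMulVec ![0, 2 * r, 2 * s] ![0, r, s] := by
    ext i j
    fin_cases i <;> fin_cases j <;> simp [Matrix.vecMulVec_apply] <;> ring
  rw [this]
  exact Matrix.rank_vecMulVec_le _ _

lemma rank_cusp (A B C : ℂ) (h : B ^ 2 - 4 * A * C ≠ 0) :
    2 ≤ (!![0, 0, 0; 0, 2 * A, B; 0, B, 2 * C] : Matrix (Fin 3) (Fin 3) ℂ).rank := by
  obtain ⟨t, ht⟩ : ∃ t : ℂ, t * (B ^ 2 - 4 * A * C) = 1 := ⟨_, inv_mul_cancel₀ h⟩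
  have key : (!![0, 0, 0; 0, 2 * A, B; 0, B, 2 * C] : Matrix (Fin 3) (Fin 3) ℂ)
      * !![0, 0, 0; 0, -t * (2 * C), t * B; 0, t * B, -t * (2 * A)]
      = Matrix.diagonal ![0, 1, 1] := by
    ext i j
    fin_cases i <;> fin_cases j <;> simp [Matrix.mul_apply, Fin.sum_univ_three] <;>
      first | ring1 | linear_combination ht
  have h2 : (Matrix.diagonal ![(0 : ℂ), 1, 1]).rank = 2 := by
    rw [Matrix.rank_diagonal, Fintype.card_subtype]
    have : (Finset.univ.filter fun i : Fin 3 => ![(0 : ℂ), 1, 1] i ≠ 0) = {1, 2} := by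
      ext i; fin_cases i <;> simp
    rw [this]
    rfl
  rw [← key] at h2
  exact h2.ge.trans (Matrix.rank_mul_le_left _ _)

/-- An irreducible polynomial is not a product of two polynomials vanishing at the origin,
even after a linear change of coordinates. -/
lemma not_prod {F : MvPolynomial (Fin 3) ℂ} (hirr : Irreducible F) {g : (Fin 3 → ℂ) → ℂ}
    (h : LinEq (fun x => eval x F) g) (P Q : MvPolynomial (Fin 3) ℂ)
    (hP : eval 0 P = 0) (hQ : eval 0 Q = 0) (hg : ∀ x, g x = eval x P * eval x Q) : False := by
  obtain ⟨M, N, hMN, hNM, e⟩ := h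
  let φ : MvPolynomial (Fin 3) ℂ →ₐ[ℂ] MvPolynomial (Fin 3) ℂ :=
    MvPolynomial.aeval fun i => ∑ j, MvPolynomial.C (N i j) * MvPolynomial.X j
  have hφ : ∀ R x, eval x (φ R) = eval (N.mulVec x) R := by
    intro R x
    induction R using MvPolynomial.induction_on with
    | C a => simp [φ]
    | add p q hp hq => simp [hp, hq]
    | mul_X p i hp =>
      rw [map_mul, map_mul, hp, map_mul]
      congr 1
      simp [φ, Matrix.mulVec, dotProduct]
  have hF : F = φ P * φ Q := by
    apply MvPolynomial.funext
    intro x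
    rw [map_mul, hφ, hφ, ← hg, ← e, Matrix.mulVec_mulVec, hMN, Matrix.one_mulVec]
  have hnu : ∀ R : MvPolynomial (Fin 3) ℂ, MvPolynomial.eval 0 R = 0 → ¬ IsUnit (φ R) := by
    intro R hR hu
    have := hu.map (MvPolynomial.eval (0 : Fin 3 → ℂ))
    rw [hφ, Matrix.mulVec_zero, hR] at this
    simp at this
  rcases hirr.isUnit_or_isUnit hF with h | h
  · exact hnu P hP h
  · exact hnu Q hQ h

lemma node_ne {F : MvPolynomial (Fin 3) ℂ} (hirr : Irreducible F) {a b c d : ℂ}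
    (h : LinEq (fun x => eval x F) (gform 0 1 0 a b c d)) : a ≠ 0 ∧ d ≠ 0 := by
  constructor
  · rintro rfl
    refine not_prod hirr h (MvPolynomial.X 2)
      (MvPolynomial.X 0 * MvPolynomial.X 1 + MvPolynomial.C b * MvPolynomial.X 1 ^ 2
        + MvPolynomial.C c * MvPolynomial.X 1 * MvPolynomial.X 2
        + MvPolynomial.C d * MvPolynomial.X 2 ^ 2) (by simp) (by simp) fun x => ?_
    simp [gform]
    ring
  · rintro rfl
    refine not_prod hirr h (MvPolynomial.X 1)
      (MvPolynomial.X 0 * MvPolynomial.X 2 + MvPolynomial.C a * MvPolynomial.X 1 ^ 2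
        + MvPolynomial.C b * MvPolynomial.X 1 * MvPolynomial.X 2
        + MvPolynomial.C c * MvPolynomial.X 2 ^ 2) (by simp) (by simp) fun x => ?_
    simp [gform]
    ring

lemma card_cube_roots : {ω : ℂ | ω ^ 3 = 1}.ncard = 3 := by
  have h := (Complex.isPrimitiveRoot_exp 3 (by norm_num)).card_nthRootsFinset
  rw [← Set.ncard_coe_finset] at h
  refine Eq.trans ?_ h
  congr 1
  ext ω
  simp [Polynomial.mem_nthRootsFinset]

lemma node_case {F : MvPolynomial (Fin 3) ℂ} (hF : Cub10 F) (hirr : Irreducible F)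
    {p : Fin 3 → ℂ} (hp : p ≠ 0) (h : IsNodeAt F p) : LinEq (fun x => eval x F) nodeF := by
  obtain ⟨hs, hr⟩ := h
  obtain ⟨h0, h1⟩ := singAt_imp hF hs
  obtain ⟨M, N, hMN, hNM, hMp, A, B, C, a, b, c, d, e⟩ :=
    sing_form (isCubic_of_cub10 hF) p hp h0 h1
  rw [hess_rank hF hMN hMp e] at hr
  have hD : B ^ 2 - 4 * A * C ≠ 0 := by
    intro hD
    have := rank_node A B C hD
    omega
  obtain ⟨α, β, γ, δ, hdet, q1, q2, q3⟩ := quad_node A B C hD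
  have l1 : LinEq (fun x => eval x F) (gform A B C a b c d) := ⟨M, N, hMN, hNM, e⟩
  have l2 := l1.trans (gform_subst A B C a b c d α β γ δ 0 1 0 hdet q1 q2 q3)
  obtain ⟨ha, hd⟩ := node_ne hirr l2
  exact l2.trans (linEq_node _ _ _ _ ha hd)

lemma cusp_case {F : MvPolynomial (Fin 3) ℂ} (hF : Cub10 F)
    {p : Fin 3 → ℂ} (hp : p ≠ 0) (h : IsCuspAt F p) : LinEq (fun x => eval x F) cuspF := by
  obtain ⟨hs, hr, hv⟩ := h
  obtain ⟨h0, h1⟩ := singAt_imp hF hs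
  obtain ⟨M, N, hMN, hNM, hMp, A, B, C, a, b, c, d, e⟩ :=
    sing_form (isCubic_of_cub10 hF) p hp h0 h1
  rw [hess_rank hF hMN hMp e] at hr
  have hD : B ^ 2 - 4 * A * C = 0 := by
    by_contra hD
    have := rank_cusp A B C hD
    omega
  obtain ⟨r, s, rfl, rfl, rfl⟩ := quad_cusp A B C hD
  have hrs : ¬ (r = 0 ∧ s = 0) := by
    rintro ⟨rfl, rfl⟩
    have hz : (!![0, 0, 0; 0, 2 * (0 : ℂ) ^ 2, 2 * 0 * 0; 0, 2 * 0 * 0, 2 * 0 ^ 2] :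
        Matrix (Fin 3) (Fin 3) ℂ) = 0 := by
      ext i j
      fin_cases i <;> fin_cases j <;> simp
    rw [hz, Matrix.rank_zero] at hr
    omega
  have hli : LinearIndependent ℂ ![p, M.mulVec ![0, s, -r]] := by
    rw [← hMp]
    apply li_map hNM
    rw [LinearIndependent.pair_iff]
    intro x y hxy
    have e0 := congrFun hxy 0
    have e1 := congrFun hxy 1
    have e2 := congrFun hxy 2
    simp at e0 e1 e2
    refine ⟨e0, ?_⟩
    by_contra hy
    exact hrs ⟨by tauto, by tauto⟩
  have hker : (hessMat F p).mulVec (M.mulVec ![0, s, -r]) = 0 := by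
    have hz : ∀ u, M.mulVec u ⬝ᵥ (hessMat F p).mulVec (M.mulVec ![0, s, -r]) = 0 := by
      intro u
      rw [← Tt_eq hF, ← hMp, Tt_comp (f := fun x => eval x F) e]
      rw [Tt_gform]
      simp
      ring
    rw [← dotProduct_eq_zero_iff]
    intro u
    rw [dotProduct_comm]
    have := hz (N.mulVec u)
    rwa [Matrix.mulVec_mulVec, hMN, Matrix.one_mulVec] at this
  have hne := hv _ hker hli
  rw [cubicForm_eq hF, e] at hne
  have hd : a * s ^ 3 + b * s ^ 2 * (-r) + c * s * (-r) ^ 2 + d * (-r) ^ 3 ≠ 0 := by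
    intro hd
    apply hne
    simp [gform]
    linear_combination hd
  obtain ⟨α, γ, hαγ⟩ : ∃ α γ : ℂ, r * α + s * γ = 1 := by
    by_cases hr0 : r = 0
    · have hs0 : s ≠ 0 := fun h => hrs ⟨hr0, h⟩
      exact ⟨0, 1 / s, by field_simp; ring⟩
    · exact ⟨1 / r, 0, by field_simp; ring⟩
  have l1 : LinEq (fun x => eval x F) (gform (r ^ 2) (2 * r * s) (s ^ 2) a b c d) :=
    ⟨M, N, hMN, hNM, e⟩
  have l2 := l1.trans (gform_subst _ _ _ a b c d α s γ (-r) 1 0 0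
    (by
      have : α * -r - s * γ = -1 := by linear_combination -hαγ
      rw [this]; norm_num)
    (by linear_combination (r * α + s * γ + 1) * hαγ) (by ring) (by ring))
  exact l2.trans (linEq_cusp _ _ _ _ hd)

theorem flex_lines_of_singular_cubic
    (F : MvPolynomial (Fin 3) ℂ) (hF : F.IsHomogeneous 3) (hirr : Irreducible F)
    (p₀ : Fin 3 → ℂ) (hp₀ : p₀ ≠ 0) :
    -- an irreducible plane cubic with a node has exactly 3 lines meeting it at a
    -- smooth point with multiplicity 3:
    (IsNodeAt F p₀ →
      {l : Projectivization ℂ (Fin 3 → ℂ) | IsSmoothFlexLine F l.rep}.ncard = 3) ∧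
    -- and an irreducible plane cubic with a cusp has exactly 1 such line:
    (IsCuspAt F p₀ →
      {l : Projectivization ℂ (Fin 3 → ℂ) | IsSmoothFlexLine F l.rep}.ncard = 1) := by
  have hC := cub10_of_homog hF
  simp only [flex_iff hC]
  refine ⟨fun h => ?_, fun h => ?_⟩
  · rw [count (node_case hC hirr hp₀ h) {ω : ℂ | ω ^ 3 = 1}
      (fun ω => ![1, -3 * ω, -3 * ω ^ 2]) (fun _ => rfl) ?_ flex_node]
    · exact card_cube_roots
    · intro i j hij
      have := congrFun hij 1
      simpa using this
  · rw [count (cusp_case hC hp₀ h) (Set.univ : Set Unit)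
      (fun _ => ![1, 0, 0]) (fun _ => rfl) (fun _ _ _ => rfl) flex_cusp]
    simp

end Infl
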